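/- arXiv:2011.06898 — 2 statements merged into one kernel-verified Lean document; each statement's English description precedes it below -/
import Mathlib

section
/- Let λ > 0, let k ≥ 1 be an integer, and let W be uniformly distributed on (0, 1). Define Z = log((1+λ)·W^{−1/k} − λ). Then Z > 0 almost surely, and for every t ≥ 0, P(Z ≤ t) = 1 − ((1+λ)/(λ + exp(t)))^{k}. Moreover, this is exactly the conditional distribution of log λ + ε given log λ + ε > 0 when ε has the type II generalized logistic distribution GL_II(k): for every t ≥ 0, P(Z ≤ t) = P(log λ + ε ≤ t | log λ + ε > 0). -/
open MeasureTheory ProbabilityTheory Real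

/-- The type II generalized logistic distribution `GL_II ν`:
density `x ↦ ν * exp x / (1 + exp x) ^ (ν + 1)`. -/
noncomputable def glTypeII (ν : ℝ) : Measure ℝ :=
  MeasureTheory.volume.withDensity fun x =>
    ENNReal.ofReal (ν * Real.exp x / (1 + Real.exp x) ^ (ν + 1))

theorem gl_Ioi (k : ℕ) (hk : 1 ≤ k) (a : ℝ) :
    glTypeII (k : ℝ) (Set.Ioi a) = ENNReal.ofReal (((1 + Real.exp a) ^ k)⁻¹) := by
  have hd : ∀ x ∈ Set.Ici a, HasDerivAt (fun x : ℝ => -((1 + Real.exp x) ^ k)⁻¹)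
      ((k : ℝ) * Real.exp x / (1 + Real.exp x) ^ ((k : ℝ) + 1)) x := by
    intro x _
    have hpos : 0 < 1 + Real.exp x := by positivity
    have h := (((((Real.hasDerivAt_exp x).const_add 1).pow k).inv (pow_ne_zero k hpos.ne')).neg)
    refine h.congr_deriv ?_
    rw [Real.rpow_add_one hpos.ne', Real.rpow_natCast]
    obtain ⟨m, rfl⟩ := Nat.exists_eq_add_of_le' hk
    simp only [Nat.add_sub_cancel, Pi.pow_apply]
    field_simp
    ring
  have hn : ∀ x ∈ Set.Ioi a,
      0 ≤ (k : ℝ) * Real.exp x / (1 + Real.exp x) ^ ((k : ℝ) + 1) := by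
    intro x _
    positivity
  have hl : Filter.Tendsto (fun x : ℝ => -((1 + Real.exp x) ^ k)⁻¹) Filter.atTop (nhds 0) := by
    rw [← neg_zero]
    refine Filter.Tendsto.neg (Filter.Tendsto.inv_tendsto_atTop ?_)
    exact (Filter.tendsto_pow_atTop (by omega)).comp
      (Filter.tendsto_atTop_add_const_left _ 1 Real.tendsto_exp_atTop)
  rw [glTypeII, withDensity_apply _ measurableSet_Ioi,
    ← ofReal_integral_eq_lintegral_ofReal
      (integrableOn_Ioi_deriv_of_nonneg' hd hn hl)
      ((ae_restrict_iff' measurableSet_Ioi).2 (Filter.Eventually.of_forall hn)),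
    integral_Ioi_of_hasDerivAt_of_nonneg' hd hn hl]
  simp

theorem key_iff (lam : ℝ) (hlam : 0 < lam) (k : ℕ) (hk : 1 ≤ k) (t w : ℝ)
    (hw : w ∈ Set.Ioo (0 : ℝ) 1) :
    0 < Real.log ((1 + lam) * w ^ (-(1 : ℝ) / (k : ℝ)) - lam) ∧
    (Real.log ((1 + lam) * w ^ (-(1 : ℝ) / (k : ℝ)) - lam) ≤ t ↔
      ((1 + lam) / (lam + Real.exp t)) ^ k ≤ w) := by
  obtain ⟨h0, h1⟩ := hw
  have hk0 : k ≠ 0 := by omega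
  have hv0 : 0 < w ^ ((k : ℝ)⁻¹) := Real.rpow_pos_of_pos h0 _
  have hv1 : w ^ ((k : ℝ)⁻¹) < 1 := Real.rpow_lt_one h0.le h1 (by positivity)
  have hvk : (w ^ ((k : ℝ)⁻¹)) ^ k = w := Real.rpow_inv_natCast_pow h0.le hk0
  have he : w ^ (-(1 : ℝ) / (k : ℝ)) = (w ^ ((k : ℝ)⁻¹))⁻¹ := by
    rw [← Real.rpow_neg h0.le]; congr 1; rw [neg_div, one_div]
  rw [he]
  generalize w ^ ((k : ℝ)⁻¹) = v at *
  have hvi : 1 < v⁻¹ := (one_lt_inv₀ hv0).2 hv1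
  have hgt : 1 < (1 + lam) * v⁻¹ - lam := by nlinarith
  refine ⟨Real.log_pos hgt, ?_⟩
  have hE := Real.exp_pos t
  rw [Real.log_le_iff_le_exp (by linarith), ← hvk,
    pow_le_pow_iff_left₀ (by positivity) hv0.le hk0, div_le_iff₀ (by positivity),
    sub_le_iff_le_add, ← div_eq_mul_inv, div_le_iff₀ hv0]
  constructor <;> intro h <;> nlinarith

/-- If `W ~ Uniform (0,1)` then `Z = log ((1+λ) * W^(-1/k) - λ)` is a.s. positive with
`P (Z ≤ t) = 1 - ((1+λ)/(λ + exp t))^k` for `t ≥ 0`; this is exactly the conditional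
distribution of `log λ + ε` given `log λ + ε > 0` when `ε ~ GL_II k`. -/
theorem inverse_cdf_sampling_glII_truncated
    {Ω : Type*} [MeasurableSpace Ω] (P : Measure Ω) [IsProbabilityMeasure P]
    {Ω' : Type*} [MeasurableSpace Ω'] (P' : Measure Ω') [IsProbabilityMeasure P']
    (lam : ℝ) (hlam : 0 < lam) (k : ℕ) (hk : 1 ≤ k)
    (W : Ω → ℝ) (hW : Measurable W)
    (hWlaw : Measure.map W P = MeasureTheory.volume.restrict (Set.Ioo (0 : ℝ) 1))
    (ε : Ω' → ℝ) (hε : Measurable ε)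
    (hεlaw : Measure.map ε P' = glTypeII (k : ℝ)) :
    (∀ᵐ ω ∂P, 0 < Real.log ((1 + lam) * W ω ^ (-(1 : ℝ) / (k : ℝ)) - lam)) ∧
    (∀ t : ℝ, 0 ≤ t →
      P {ω | Real.log ((1 + lam) * W ω ^ (-(1 : ℝ) / (k : ℝ)) - lam) ≤ t} =
        ENNReal.ofReal (1 - ((1 + lam) / (lam + Real.exp t)) ^ k)) ∧
    (∀ t : ℝ, 0 ≤ t →
      P {ω | Real.log ((1 + lam) * W ω ^ (-(1 : ℝ) / (k : ℝ)) - lam) ≤ t} =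
        (P'[|{ω | 0 < Real.log lam + ε ω}]) {ω | Real.log lam + ε ω ≤ t}) := by
  have hWae : ∀ᵐ ω ∂P, W ω ∈ Set.Ioo (0 : ℝ) 1 := by
    have : ∀ᵐ w ∂(Measure.map W P), w ∈ Set.Ioo (0 : ℝ) 1 := by
      rw [hWlaw]; exact ae_restrict_mem measurableSet_Ioo
    exact ae_of_ae_map hW.aemeasurable this
  have h2 : ∀ t : ℝ, 0 ≤ t →
      P {ω | Real.log ((1 + lam) * W ω ^ (-(1 : ℝ) / (k : ℝ)) - lam) ≤ t} =
        ENNReal.ofReal (1 - ((1 + lam) / (lam + Real.exp t)) ^ k) := by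
    intro t ht
    have hc : 0 < ((1 + lam) / (lam + Real.exp t)) ^ k := by positivity
    have h : P {ω | Real.log ((1 + lam) * W ω ^ (-(1 : ℝ) / (k : ℝ)) - lam) ≤ t} =
        P (W ⁻¹' Set.Ici (((1 + lam) / (lam + Real.exp t)) ^ k)) := by
      apply measure_congr
      filter_upwards [hWae] with ω hω
      exact propext (key_iff lam hlam k hk t _ hω).2
    rw [h, ← Measure.map_apply hW measurableSet_Ici, hWlaw,
      Measure.restrict_apply measurableSet_Ici]
    have hs : Set.Ici (((1 + lam) / (lam + Real.exp t)) ^ k) ∩ Set.Ioo (0 : ℝ) 1 =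
        Set.Ico (((1 + lam) / (lam + Real.exp t)) ^ k) 1 := by
      ext x
      simp only [Set.mem_inter_iff, Set.mem_Ici, Set.mem_Ioo, Set.mem_Ico]
      exact ⟨fun h => ⟨h.1, h.2.2⟩, fun h => ⟨h.1, hc.trans_le h.1, h.2⟩⟩
    rw [hs, Real.volume_Ico]
  refine ⟨?_, h2, ?_⟩
  · filter_upwards [hWae] with ω hω
    exact (key_iff lam hlam k hk 0 _ hω).1
  · intro t ht
    rw [h2 t ht]
    have hs : {ω | 0 < Real.log lam + ε ω} = ε ⁻¹' Set.Ioi (-Real.log lam) := by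
      ext ω
      simp only [Set.mem_ofPred_eq, Set.mem_preimage, Set.mem_Ioi]
      constructor <;> intro h <;> linarith
    have hst : (ε ⁻¹' Set.Ioi (-Real.log lam)) ∩ {ω | Real.log lam + ε ω ≤ t} =
        ε ⁻¹' (Set.Ioi (-Real.log lam) \ Set.Ioi (t - Real.log lam)) := by
      ext ω
      simp only [Set.mem_ofPred_eq, Set.mem_preimage, Set.mem_Ioi, Set.mem_inter_iff,
        Set.mem_sdiff, not_lt]
      constructor <;> rintro ⟨h, h'⟩ <;> constructor <;> linarith
    have hA : (0 : ℝ) < ((1 + Real.exp (-Real.log lam)) ^ k)⁻¹ := by positivity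
    rw [hs, cond_apply (hε measurableSet_Ioi), hst, ← Measure.map_apply hε measurableSet_Ioi,
      ← Measure.map_apply hε (measurableSet_Ioi.diff measurableSet_Ioi), hεlaw,
      measure_sdiff (Set.Ioi_subset_Ioi (by linarith)) measurableSet_Ioi.nullMeasurableSet
        (by rw [gl_Ioi k hk]; exact ENNReal.ofReal_ne_top),
      gl_Ioi k hk, gl_Ioi k hk, ← ENNReal.ofReal_sub _ (by positivity),
      ← ENNReal.ofReal_inv_of_pos hA, ← ENNReal.ofReal_mul (by positivity)]
    congr 1
    rw [Real.exp_sub, Real.exp_neg, Real.exp_log hlam]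
    have hE := Real.exp_pos t
    have e1 : 1 + lam⁻¹ = (1 + lam) / lam := by field_simp; ring
    have e2 : 1 + Real.exp t / lam = (lam + Real.exp t) / lam := by field_simp
    rw [e1, e2, div_pow, div_pow, div_pow]
    field_simp
end

section
/- Let λ > 0, let m ≥ 1 be an integer, and let V be uniformly distributed on (0, 1). Define Z = −log(((1+λ)/λ)·V^{−1/m} − 1/λ). Then Z < 0 almost surely, and for every t ≤ 0, P(Z ≤ t) = ((1+λ)/(1 + λ·exp(−t)))^{m}. Moreover, this is exactly the conditional distribution of log λ + ε given log λ + ε < 0 when ε has the type I generalized logistic distribution GL_I(m): for every t ≤ 0, P(Z ≤ t) = P(log λ + ε ≤ t | log λ + ε < 0). -/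
open MeasureTheory ProbabilityTheory Real

/-- The type I generalized logistic distribution `GL_I ν`:
density `x ↦ ν * exp (ν x) / (1 + exp x) ^ (ν + 1)`. -/
noncomputable def glTypeI (ν : ℝ) : Measure ℝ :=
  MeasureTheory.volume.withDensity fun x =>
    ENNReal.ofReal (ν * Real.exp (ν * x) / (1 + Real.exp x) ^ (ν + 1))

theorem glTypeI_hasDerivAt (m : ℕ) (hm : 1 ≤ m) (x : ℝ) :
    HasDerivAt (fun x : ℝ => (Real.exp x / (1 + Real.exp x)) ^ m)
      ((m : ℝ) * Real.exp ((m : ℝ) * x) / (1 + Real.exp x) ^ ((m : ℝ) + 1)) x := by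
  have hpos : (0 : ℝ) < 1 + Real.exp x := by positivity
  have h1 := ((Real.hasDerivAt_exp x).div ((Real.hasDerivAt_exp x).const_add 1) hpos.ne').pow m
  refine h1.congr_deriv ?_
  obtain ⟨k, rfl⟩ : ∃ k, m = k + 1 := ⟨m - 1, by omega⟩
  have h2 : (1 + Real.exp x) ^ (((k + 1 : ℕ) : ℝ) + 1) = (1 + Real.exp x) ^ (k + 2) := by
    rw [← Real.rpow_natCast]
    congr 1
    push_cast
    ring
  rw [h2, Real.exp_nat_mul]
  simp only [Pi.div_apply, Nat.add_sub_cancel, div_pow]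
  field_simp
  ring

theorem glTypeI_Iic (m : ℕ) (hm : 1 ≤ m) (hfin : glTypeI (m : ℝ) Set.univ ≠ ⊤) (t : ℝ) :
    glTypeI (m : ℝ) (Set.Iic t) = ENNReal.ofReal ((Real.exp t / (1 + Real.exp t)) ^ m) := by
  set f : ℝ → ℝ := fun x => (m : ℝ) * Real.exp ((m : ℝ) * x) / (1 + Real.exp x) ^ ((m : ℝ) + 1)
    with hf
  have hnn : ∀ x, 0 ≤ f x := fun x => by simp only [hf]; positivity
  have hmeas : Measurable f := by simp only [hf]; fun_prop
  have hint : Integrable f := by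
    refine ⟨hmeas.aestronglyMeasurable, ?_⟩
    rw [hasFiniteIntegral_iff_ofReal (Filter.Eventually.of_forall hnn)]
    rw [glTypeI, withDensity_apply _ MeasurableSet.univ, Measure.restrict_univ] at hfin
    exact hfin.lt_top
  rw [glTypeI, withDensity_apply _ measurableSet_Iic,
    ← ofReal_integral_eq_lintegral_ofReal hint.integrableOn (Filter.Eventually.of_forall hnn)]
  congr 1
  have hlim : Filter.Tendsto (fun x : ℝ => (Real.exp x / (1 + Real.exp x)) ^ m) Filter.atBot
      (nhds 0) := by
    have h0 := Real.tendsto_exp_atBot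
    have := (h0.div (h0.const_add 1) (by norm_num)).pow m
    simpa [zero_pow (by omega : m ≠ 0)] using this
  have := integral_Iic_of_hasDerivAt_of_tendsto' (a := t) (fun x _ => glTypeI_hasDerivAt m hm x)
    hint.integrableOn hlim
  rw [this, sub_zero]

theorem glTypeI_Iio (ν : ℝ) (t : ℝ) : glTypeI ν (Set.Iio t) = glTypeI ν (Set.Iic t) := by
  have : NullSingletonClass (glTypeI ν) := by unfold glTypeI; infer_instance
  exact measure_congr Iio_ae_eq_Iic

theorem Z_iff (lam : ℝ) (hlam : 0 < lam) (m : ℕ) (hm : 1 ≤ m) (v : ℝ) (hv : v ∈ Set.Ioo (0 : ℝ) 1)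
    (t : ℝ) :
    -Real.log (((1 + lam) / lam) * v ^ (-(1 : ℝ) / (m : ℝ)) - 1 / lam) ≤ t ↔
      v ≤ ((1 + lam) / (1 + lam * Real.exp (-t))) ^ m := by
  have hm0 : (0 : ℝ) < m := by exact_mod_cast hm
  have h1 : 1 < v ^ (-(1 : ℝ) / (m : ℝ)) :=
    Real.one_lt_rpow_of_pos_of_lt_one_of_neg hv.1 hv.2 (div_neg_of_neg_of_pos (by norm_num) hm0)
  have hpos : 0 < ((1 + lam) / lam) * v ^ (-(1 : ℝ) / (m : ℝ)) - 1 / lam := by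
    rw [div_mul_eq_mul_div, ← sub_div]
    apply div_pos _ hlam
    nlinarith
  have hE := Real.exp_pos (-t)
  have hA : 0 < (1 + lam * Real.exp (-t)) / (1 + lam) := by positivity
  rw [neg_le, Real.le_log_iff_exp_le hpos]
  have e1 : Real.exp (-t) ≤ ((1 + lam) / lam) * v ^ (-(1 : ℝ) / (m : ℝ)) - 1 / lam ↔
      (1 + lam * Real.exp (-t)) / (1 + lam) ≤ v ^ (-(1 : ℝ) / (m : ℝ)) := by
    rw [div_mul_eq_mul_div, ← sub_div, le_div_iff₀ hlam, div_le_iff₀ (by positivity)]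
    constructor <;> intro h <;> linarith
  have e2 : -(1 : ℝ) / (m : ℝ) = (-(m : ℝ))⁻¹ := by rw [inv_neg]; ring
  rw [e1, e2, Real.le_rpow_inv_iff_of_neg hA hv.1 (by linarith), Real.rpow_neg hA.le,
    Real.rpow_natCast, ← inv_pow, inv_div]

theorem Z_neg (lam : ℝ) (hlam : 0 < lam) (m : ℕ) (hm : 1 ≤ m) (v : ℝ)
    (hv : v ∈ Set.Ioo (0 : ℝ) 1) :
    -Real.log (((1 + lam) / lam) * v ^ (-(1 : ℝ) / (m : ℝ)) - 1 / lam) < 0 := by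
  have hm0 : (0 : ℝ) < m := by exact_mod_cast hm
  have h1 : 1 < v ^ (-(1 : ℝ) / (m : ℝ)) :=
    Real.one_lt_rpow_of_pos_of_lt_one_of_neg hv.1 hv.2 (div_neg_of_neg_of_pos (by norm_num) hm0)
  rw [neg_lt_zero]
  apply Real.log_pos
  rw [div_mul_eq_mul_div, ← sub_div, lt_div_iff₀ hlam]
  nlinarith

/-- If `V ~ Uniform (0,1)` then `Z = -log (((1+λ)/λ) * V^(-1/m) - 1/λ)` is a.s. negative with
`P (Z ≤ t) = ((1+λ)/(1 + λ exp (-t)))^m` for `t ≤ 0`; this is exactly the conditional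
distribution of `log λ + ε` given `log λ + ε < 0` when `ε ~ GL_I m`. -/
theorem inverse_cdf_sampling_glI_truncated
    {Ω : Type*} [MeasurableSpace Ω] (P : Measure Ω) [IsProbabilityMeasure P]
    {Ω' : Type*} [MeasurableSpace Ω'] (P' : Measure Ω') [IsProbabilityMeasure P']
    (lam : ℝ) (hlam : 0 < lam) (m : ℕ) (hm : 1 ≤ m)
    (V : Ω → ℝ) (hV : Measurable V)
    (hVlaw : Measure.map V P = MeasureTheory.volume.restrict (Set.Ioo (0 : ℝ) 1))
    (ε : Ω' → ℝ) (hε : Measurable ε)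
    (hεlaw : Measure.map ε P' = glTypeI (m : ℝ)) :
    (∀ᵐ ω ∂P,
      -Real.log (((1 + lam) / lam) * V ω ^ (-(1 : ℝ) / (m : ℝ)) - 1 / lam) < 0) ∧
    (∀ t : ℝ, t ≤ 0 →
      P {ω | -Real.log (((1 + lam) / lam) * V ω ^ (-(1 : ℝ) / (m : ℝ)) - 1 / lam) ≤ t} =
        ENNReal.ofReal (((1 + lam) / (1 + lam * Real.exp (-t))) ^ m)) ∧
    (∀ t : ℝ, t ≤ 0 →
      P {ω | -Real.log (((1 + lam) / lam) * V ω ^ (-(1 : ℝ) / (m : ℝ)) - 1 / lam) ≤ t} =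
        (P'[|{ω | Real.log lam + ε ω < 0}]) {ω | Real.log lam + ε ω ≤ t}) := by
  have hmem : ∀ᵐ ω ∂P, V ω ∈ Set.Ioo (0 : ℝ) 1 := by
    apply ae_of_ae_map hV.aemeasurable
    rw [hVlaw]
    exact ae_restrict_mem measurableSet_Ioo
  have hcdf : ∀ t : ℝ, t ≤ 0 →
      P {ω | -Real.log (((1 + lam) / lam) * V ω ^ (-(1 : ℝ) / (m : ℝ)) - 1 / lam) ≤ t} =
        ENNReal.ofReal (((1 + lam) / (1 + lam * Real.exp (-t))) ^ m) := by
    intro t ht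
    have hE : 1 ≤ Real.exp (-t) := Real.one_le_exp (by linarith)
    set c := ((1 + lam) / (1 + lam * Real.exp (-t))) ^ m with hc
    have hc0 : 0 < c := by positivity
    have hc1 : c ≤ 1 := by
      apply pow_le_one₀ (by positivity)
      rw [div_le_one (by positivity)]
      nlinarith
    have h1 : P {ω | -Real.log (((1 + lam) / lam) * V ω ^ (-(1 : ℝ) / (m : ℝ)) - 1 / lam) ≤ t}
        = P (V ⁻¹' Set.Iic c) := by
      apply measure_congr
      filter_upwards [hmem] with ω hω
      exact propext (Z_iff lam hlam m hm (V ω) hω t)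
    rw [h1, ← Measure.map_apply hV measurableSet_Iic, hVlaw,
      Measure.restrict_congr_set Ioo_ae_eq_Ioc, Measure.restrict_apply measurableSet_Iic,
      Set.inter_comm, Set.Ioc_inter_Iic, min_eq_right hc1, Real.volume_Ioc, sub_zero]
  refine ⟨?_, hcdf, ?_⟩
  · filter_upwards [hmem] with ω hω
    exact Z_neg lam hlam m hm (V ω) hω
  · intro t ht
    rw [hcdf t ht]
    have hfin : glTypeI (m : ℝ) Set.univ ≠ ⊤ := by
      rw [← hεlaw, Measure.map_apply hε MeasurableSet.univ]
      exact measure_ne_top _ _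
    have hF : ∀ s : ℝ, glTypeI (m : ℝ) (Set.Iic (s - Real.log lam)) =
        ENNReal.ofReal ((1 / (1 + lam * Real.exp (-s))) ^ m) := by
      intro s
      rw [glTypeI_Iic m hm hfin]
      congr 2
      rw [Real.exp_sub, Real.exp_log hlam, Real.exp_neg]
      have := Real.exp_pos s
      field_simp
      ring
    have hlt : ∀ s : ℝ, P' {ω | Real.log lam + ε ω < s} =
        ENNReal.ofReal ((1 / (1 + lam * Real.exp (-s))) ^ m) := by
      intro s
      rw [← hF, ← glTypeI_Iio, ← hεlaw, Measure.map_apply hε measurableSet_Iio]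
      congr 1
      ext ω
      simp only [Set.mem_ofPred_eq, Set.mem_preimage, Set.mem_Iio, lt_sub_iff_add_lt']
    have hle : ∀ s : ℝ, P' {ω | Real.log lam + ε ω ≤ s} =
        ENNReal.ofReal ((1 / (1 + lam * Real.exp (-s))) ^ m) := by
      intro s
      rw [← hF, ← hεlaw, Measure.map_apply hε measurableSet_Iic]
      congr 1
      ext ω
      simp only [Set.mem_ofPred_eq, Set.mem_preimage, Set.mem_Iic, le_sub_iff_add_le']
    have hinter : P' ({ω | Real.log lam + ε ω < 0} ∩ {ω | Real.log lam + ε ω ≤ t}) =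
        ENNReal.ofReal ((1 / (1 + lam * Real.exp (-t))) ^ m) := by
      apply le_antisymm
      · rw [← hle]
        exact measure_mono Set.inter_subset_right
      · rw [← hlt]
        exact measure_mono fun ω (hω : Real.log lam + ε ω < t) => ⟨hω.trans_le ht, hω.le⟩
    have hms : MeasurableSet {ω | Real.log lam + ε ω < 0} :=
      measurableSet_lt (measurable_const.add hε) measurable_const
    rw [cond_apply hms, hinter, hlt, ← ENNReal.ofReal_inv_of_pos (by positivity),
      ← ENNReal.ofReal_mul (by positivity)]
    congr 1
    rw [← inv_pow, ← mul_pow]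
    congr 1
    simp only [neg_zero, Real.exp_zero, mul_one, one_div, inv_inv]
    rfl
end
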